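/- arXiv:1406.6922 — 2 statements merged into one kernel-verified Lean document; each statement's English description precedes it below -/
import Mathlib

section
/- For f ∈ S_β(G,a) with 0 < β < 1, the function (T_{G,a} f)(z) = (T_G f)(z) - (T_G f)(a), where (T_G f)(z) = -(1/π) ∬_G f(ζ)/(ζ-z) dA(ζ), satisfies the pointwise bound |(T_{G,a} f)(z)| ≤ M_β(G) · ||f||_{S_β(G,a)} · |z-a|^{1-β} for all z ∈ G, where M_β(G) = sup_{z∈G} (|z-a|^β/π) ∬_G dA(ζ)/(|ζ-a|^{1+β}|ζ-z|). -/
open MeasureTheory Real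

/-- Complex multiplication by `c` is a rotation followed by a real dilation. -/
lemma Complex.exists_rotation_mul_eq (c : ℂ) :
    ∃ u : Circle, ∀ w : ℂ, c * w = ‖c‖ • rotation u w := by
  refine ⟨Circle.exp (Complex.arg c), fun w => ?_⟩
  rw [rotation_apply, Complex.real_smul, Circle.coe_exp, ← mul_assoc,
    Complex.norm_mul_exp_arg_mul_I]

lemma Complex.integrable_comp_mul_left_iff {F : ℂ → ℝ} {c : ℂ} (hc : c ≠ 0) :
    Integrable (fun w => F (c * w)) ↔ Integrable F := by
  obtain ⟨u, hu⟩ := Complex.exists_rotation_mul_eq c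
  simp_rw [hu]
  rw [← integrable_comp_smul_iff volume F (norm_ne_zero_iff.2 hc)]
  exact (rotation u).measurePreserving.integrable_comp_emb
    (rotation u).toHomeomorph.measurableEmbedding (g := fun w => F (‖c‖ • w))

lemma Complex.integral_comp_mul_left (F : ℂ → ℝ) (c : ℂ) :
    ∫ w, F (c * w) = (‖c‖ ^ 2)⁻¹ * ∫ w, F w := by
  obtain ⟨u, hu⟩ := Complex.exists_rotation_mul_eq c
  simp_rw [hu]
  rw [(rotation u).measurePreserving.integral_comp
    (rotation u).toHomeomorph.measurableEmbedding (fun w => F (‖c‖ • w)),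
    Measure.integral_comp_smul_of_nonneg volume F ‖c‖ (hR := norm_nonneg c), Complex.finrank_real_complex,
    smul_eq_mul]

lemma integrable_one_div_norm_rpow_mul_norm_sub_one {p : ℝ} (hp1 : 1 < p) (hp2 : p < 2) :
    Integrable (fun w : ℂ => 1 / (‖w‖ ^ p * ‖w - 1‖)) := by
  have hmeas : Measurable (fun w : ℂ => 1 / (‖w‖ ^ p * ‖w - 1‖)) := by fun_prop
  have hball0 : IntegrableOn (fun w : ℂ => 1 / (‖w‖ ^ p * ‖w - 1‖)) (Metric.ball 0 (1 / 2)) := by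
    refine integrableOn_ball_of_norm_le_rpow (C := 2) (α := p) (by simp) (by simpa) ?_
      hmeas.aestronglyMeasurable
    filter_upwards [ae_restrict_mem measurableSet_ball] with w hw
    rw [mem_ball_zero_iff] at hw
    have h1 : 1 / 2 ≤ ‖w - 1‖ := by
      have := norm_sub_norm_le (1 : ℂ) w
      rw [norm_sub_rev, norm_one] at this
      linarith
    rw [Real.norm_of_nonneg (by positivity), rpow_neg (norm_nonneg w), one_div, mul_inv, mul_comm]
    gcongr
    exact inv_le_of_inv_le₀ (by norm_num) (by linarith)
  have hball1 : IntegrableOn (fun w : ℂ => 1 / (‖w‖ ^ p * ‖w - 1‖)) (Metric.ball 1 (1 / 2)) := by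
    have h : IntegrableOn (fun w : ℂ => 1 / (‖w + 1‖ ^ p * ‖w‖)) (Metric.ball 0 (1 / 2)) := by
      refine integrableOn_ball_of_norm_le_rpow (C := 2 ^ p) (α := 1) (by simp) (by simp) ?_
        (Measurable.aestronglyMeasurable (by fun_prop))
      filter_upwards [ae_restrict_mem measurableSet_ball] with w hw
      rw [mem_ball_zero_iff] at hw
      have h1 : 1 / 2 ≤ ‖w + 1‖ := by
        have := norm_sub_norm_le (1 : ℂ) (-w)
        rw [sub_neg_eq_add, norm_neg, norm_one, add_comm] at this
        linarith
      rw [Real.norm_of_nonneg (by positivity), rpow_neg_one, one_div, mul_inv,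
        ← inv_rpow (norm_nonneg _)]
      gcongr
      exact inv_le_of_inv_le₀ (by norm_num) (by linarith)
    rw [← integrable_indicator_iff measurableSet_ball] at h ⊢
    convert! h.comp_sub_right 1 using 2 with w
    simp [Set.indicator, dist_eq_norm]
  have hfar : IntegrableOn (fun w : ℂ => 1 / (‖w‖ ^ p * ‖w - 1‖))
      (Metric.ball 0 (1 / 2) ∪ Metric.ball 1 (1 / 2))ᶜ := by
    have hdom : Integrable (fun w : ℂ => 3 ^ p * 5 * (1 + ‖w‖) ^ (-(p + 1))) :=
      (integrable_one_add_norm (by rw [Complex.finrank_real_complex]; push_cast; linarith)).const_mul _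
    refine hdom.integrableOn.mono' hmeas.aestronglyMeasurable ?_
    filter_upwards [ae_restrict_mem (measurableSet_ball.union measurableSet_ball).compl] with w hw
    simp only [Set.compl_union, Set.mem_inter_iff, Set.mem_compl_iff, Metric.mem_ball,
      dist_eq_norm, sub_zero, not_lt] at hw
    obtain ⟨h0, h1⟩ := hw
    have htri : ‖w‖ ≤ ‖w - 1‖ + 1 := by simpa using norm_add_le (w - 1) 1
    have hpos : 0 < 1 + ‖w‖ := by positivity
    have ha : (1 + ‖w‖) / 3 ≤ ‖w‖ := by linarith
    have hb : (1 + ‖w‖) / 5 ≤ ‖w - 1‖ := by linarith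
    rw [Real.norm_of_nonneg (by positivity)]
    calc 1 / (‖w‖ ^ p * ‖w - 1‖) ≤ 1 / (((1 + ‖w‖) / 3) ^ p * ((1 + ‖w‖) / 5)) := by
          gcongr
      _ = 3 ^ p * 5 * (1 + ‖w‖) ^ (-(p + 1)) := by
          rw [div_rpow hpos.le (by norm_num), rpow_neg hpos.le, rpow_add_one hpos.ne']
          field_simp
  rw [← integrableOn_univ, ← Set.union_compl_self (Metric.ball (0 : ℂ) (1 / 2) ∪ Metric.ball 1 (1 / 2))]
  exact (hball0.union hball1).union hfar

lemma one_div_norm_rpow_mul_norm_sub_comp_mul_left (p : ℝ) (c w : ℂ) :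
    1 / (‖c * w‖ ^ p * ‖c * w - c‖) = (‖c‖ ^ p * ‖c‖)⁻¹ * (1 / (‖w‖ ^ p * ‖w - 1‖)) := by
  rw [show c * w - c = c * (w - 1) by ring, norm_mul, norm_mul,
    mul_rpow (norm_nonneg _) (norm_nonneg _), one_div, one_div, ← mul_inv]
  ring_nf

lemma integrable_one_div_norm_sub_rpow_mul_norm_sub {p : ℝ} (hp1 : 1 < p) (hp2 : p < 2)
    {a z : ℂ} (hz : z ≠ a) :
    Integrable (fun ζ : ℂ => 1 / (‖ζ - a‖ ^ p * ‖ζ - z‖)) := by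
  have hc : z - a ≠ 0 := sub_ne_zero.2 hz
  have h : Integrable (fun w : ℂ => 1 / (‖w‖ ^ p * ‖w - (z - a)‖)) := by
    rw [← Complex.integrable_comp_mul_left_iff hc]
    simp_rw [one_div_norm_rpow_mul_norm_sub_comp_mul_left]
    exact (integrable_one_div_norm_rpow_mul_norm_sub_one hp1 hp2).const_mul _
  simpa using h.comp_sub_right a

lemma integral_one_div_norm_sub_rpow_mul_norm_sub (p : ℝ) {a z : ℂ} (hz : z ≠ a) :
    ∫ ζ : ℂ, 1 / (‖ζ - a‖ ^ p * ‖ζ - z‖)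
      = ‖z - a‖ ^ (1 - p) * ∫ w : ℂ, 1 / (‖w‖ ^ p * ‖w - 1‖) := by
  have hc : z - a ≠ 0 := sub_ne_zero.2 hz
  have hn : 0 < ‖z - a‖ := norm_pos_iff.2 hc
  have h := Complex.integral_comp_mul_left (fun w : ℂ => 1 / (‖w‖ ^ p * ‖w - (z - a)‖)) (z - a)
  simp_rw [one_div_norm_rpow_mul_norm_sub_comp_mul_left] at h
  rw [integral_const_mul] at h
  have ht := integral_sub_right_eq_self (μ := volume)
    (fun w : ℂ => 1 / (‖w‖ ^ p * ‖w - (z - a)‖)) a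
  simp only [sub_sub_sub_cancel_right] at ht
  rw [ht, rpow_sub hn, rpow_one]
  field_simp at h ⊢
  linarith

/-- The quantities whose supremum is the constant `M_β(G)` are bounded uniformly in `z`. -/
lemma bddAbove_norm_sub_rpow_div_pi_mul_integral (G : Set ℂ) (a : ℂ) {β : ℝ}
    (hβ0 : 0 < β) (hβ1 : β < 1) :
    BddAbove {r : ℝ | ∃ z ∈ G,
      r = ‖z - a‖ ^ β / π * ∫ ζ in G, 1 / (‖ζ - a‖ ^ (1 + β) * ‖ζ - z‖)} := by
  refine ⟨(∫ w : ℂ, 1 / (‖w‖ ^ (1 + β) * ‖w - 1‖)) / π, ?_⟩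
  rintro r ⟨z, -, rfl⟩
  rcases eq_or_ne z a with rfl | hz
  · rw [sub_self, norm_zero, zero_rpow hβ0.ne', zero_div, zero_mul]
    exact div_nonneg (integral_nonneg fun w => by positivity) pi_pos.le
  · have hn : 0 < ‖z - a‖ := norm_pos_iff.2 (sub_ne_zero.2 hz)
    calc ‖z - a‖ ^ β / π * ∫ ζ in G, 1 / (‖ζ - a‖ ^ (1 + β) * ‖ζ - z‖)
        ≤ ‖z - a‖ ^ β / π * ∫ ζ, 1 / (‖ζ - a‖ ^ (1 + β) * ‖ζ - z‖) := by
          have hint : Integrable (fun ζ : ℂ => 1 / (‖ζ - a‖ ^ (1 + β) * ‖ζ - z‖)) :=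
            integrable_one_div_norm_sub_rpow_mul_norm_sub (by linarith) (by linarith) hz
          exact mul_le_mul_of_nonneg_left (setIntegral_le_integral hint
            (.of_forall fun ζ => by positivity)) (by positivity)
      _ = (∫ w : ℂ, 1 / (‖w‖ ^ (1 + β) * ‖w - 1‖)) / π := by
          rw [integral_one_div_norm_sub_rpow_mul_norm_sub _ hz, sub_add_cancel_left,
            rpow_neg hn.le]
          field_simp

/-- For `f ∈ S_β(G,a)` with `0 < β < 1`, the function
`(T_{G,a}f)(z) = (T_G f)(z) - (T_G f)(a)`, with `(T_G f)(z) = -(1/π)∬_G f(ζ)/(ζ-z) dA(ζ)`,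
satisfies `|(T_{G,a}f)(z)| ≤ M_β(G) ‖f‖_{S_β(G,a)} |z-a|^{1-β}` on `G`, where
`M_β(G) = sup_{z∈G} (|z-a|^β/π) ∬_G dA(ζ)/(|ζ-a|^{1+β}|ζ-z|)`. -/
theorem TGa_pointwise_bound
    (G : Set ℂ) (hGo : IsOpen G) (hGb : Bornology.IsBounded G)
    (a : ℂ) (ha : a ∈ G) (β : ℝ) (hβ0 : 0 < β) (hβ1 : β < 1)
    (f : ℂ → ℂ) (hf : Measurable f)
    (hbdd : ∃ C, ∀ᵐ z ∂(volume.restrict G), ‖z - a‖ ^ β * ‖f z‖ ≤ C)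
    (hint : ∀ z ∈ G, Integrable (fun ζ => f ζ / (ζ - z)) (volume.restrict G))
    -- the Carleman–Vekua integral operator `T_G`
    (T : (ℂ → ℂ) → ℂ → ℂ)
    (hT : ∀ g z, T g z = -(1 / (π : ℂ)) * ∫ ζ in G, g ζ / (ζ - z))
    -- the constant `M_β(G)`
    (Mβ : ℝ)
    (hM : Mβ = sSup {r : ℝ | ∃ z ∈ G,
      r = ‖z - a‖ ^ β / π * ∫ ζ in G, 1 / (‖ζ - a‖ ^ (1 + β) * ‖ζ - z‖)})
    -- the norm `‖f‖_{S_β(G,a)}`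
    (N : ℝ) (hN : N = essSup (fun z => ‖z - a‖ ^ β * ‖f z‖) (volume.restrict G)) :
    ∀ z ∈ G, ‖T f z - T f a‖ ≤ Mβ * N * ‖z - a‖ ^ (1 - β) := by
  intro z hz
  rcases eq_or_ne z a with rfl | hza
  · simp [zero_rpow (sub_pos.2 hβ1).ne']
  have hn : 0 < ‖z - a‖ := norm_pos_iff.2 (sub_ne_zero.2 hza)
  have hNae : ∀ᵐ ζ ∂(volume.restrict G), ‖ζ - a‖ ^ β * ‖f ζ‖ ≤ N := by
    rw [hN]
    exact ae_le_essSup hbdd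
  have hN0 : 0 ≤ N := by
    have : (ae (volume.restrict G)).NeBot := by
      rw [ae_neBot, Ne, Measure.restrict_eq_zero]
      exact (hGo.measure_pos volume ⟨a, ha⟩).ne'
    obtain ⟨ζ, hζ⟩ := hNae.exists
    exact (by positivity : (0 : ℝ) ≤ _).trans hζ
  have hker : IntegrableOn (fun ζ : ℂ => 1 / (‖ζ - a‖ ^ (1 + β) * ‖ζ - z‖)) G :=
    (integrable_one_div_norm_sub_rpow_mul_norm_sub (by linarith) (by linarith) hza).integrableOn
  have hdiff : ‖(∫ ζ in G, f ζ / (ζ - z)) - ∫ ζ in G, f ζ / (ζ - a)‖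
      ≤ ‖z - a‖ * N * ∫ ζ in G, 1 / (‖ζ - a‖ ^ (1 + β) * ‖ζ - z‖) := by
    rw [← integral_sub (hint z hz) (hint a ha), ← integral_const_mul]
    refine norm_integral_le_of_norm_le (hker.const_mul _) ?_
    filter_upwards [hNae, ae_restrict_of_ae (Measure.ae_ne volume a),
      ae_restrict_of_ae (Measure.ae_ne volume z)] with ζ hζ hζa hζz
    have hζa' := sub_ne_zero.2 hζa
    have hζz' := sub_ne_zero.2 hζz
    have hna : 0 < ‖ζ - a‖ := norm_pos_iff.2 hζa'
    have hnz : 0 < ‖ζ - z‖ := norm_pos_iff.2 hζz'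
    have heq : f ζ / (ζ - z) - f ζ / (ζ - a) = f ζ * (z - a) / ((ζ - a) * (ζ - z)) := by
      field_simp
      ring
    calc ‖f ζ / (ζ - z) - f ζ / (ζ - a)‖
        = ‖z - a‖ * (‖ζ - a‖ ^ β * ‖f ζ‖) * (1 / (‖ζ - a‖ ^ (1 + β) * ‖ζ - z‖)) := by
          rw [heq, norm_div, norm_mul, norm_mul, rpow_add hna, rpow_one]
          field_simp
      _ ≤ ‖z - a‖ * N * (1 / (‖ζ - a‖ ^ (1 + β) * ‖ζ - z‖)) := by gcongr
  have hle : ‖z - a‖ ^ β / π * (∫ ζ in G, 1 / (‖ζ - a‖ ^ (1 + β) * ‖ζ - z‖)) ≤ Mβ := by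
    rw [hM]
    exact le_csSup (bddAbove_norm_sub_rpow_div_pi_mul_integral G a hβ0 hβ1) ⟨z, hz, rfl⟩
  calc ‖T f z - T f a‖
      = 1 / π * ‖(∫ ζ in G, f ζ / (ζ - z)) - ∫ ζ in G, f ζ / (ζ - a)‖ := by
        rw [hT, hT, ← mul_sub, norm_mul]
        simp [abs_of_pos pi_pos]
    _ ≤ 1 / π * (‖z - a‖ * N * ∫ ζ in G, 1 / (‖ζ - a‖ ^ (1 + β) * ‖ζ - z‖)) := by gcongr
    _ = (‖z - a‖ ^ β / π * ∫ ζ in G, 1 / (‖ζ - a‖ ^ (1 + β) * ‖ζ - z‖)) * N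
          * ‖z - a‖ ^ (1 - β) := by
        rw [rpow_sub hn, rpow_one]
        field_simp
    _ ≤ Mβ * N * ‖z - a‖ ^ (1 - β) := by gcongr
end

section
/- The operator P_{G,a}, defined by (P_{G,a}f)(z) = (T_{G,a} f*)(z) with f* = A f + B conj(f), satisfies the Lipschitz estimate ||P_{G,a}f_1 - P_{G,a}f_2||_{C_{β-1}(Ḡ,a)} ≤ μ M_β(G) ||f_1 - f_2||_{C_{β-1}(Ḡ,a)} for all f_1, f_2 ∈ C_{β-1}(Ḡ,a), where μ = ||A||_{S_1(G,a)} + ||B||_{S_1(G,a)}. -/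
open MeasureTheory Real

lemma integrable_indicator_ball_norm_rpow {s : ℝ} (hs : s < 2) (r : ℝ) :
    Integrable ((Metric.ball (0 : ℂ) r).indicator fun w => ‖w‖ ^ (-s)) := by
  rw [integrable_indicator_iff measurableSet_ball,
    integrableOn_fun_norm_addHaar volume (f := fun y : ℝ => y ^ (-s))]
  rcases le_or_gt r 0 with hr | hr
  · simp [Set.Ioo_eq_empty (not_lt.mpr hr)]
  · have h := (intervalIntegral.integrableOn_Ioo_rpow_iff (s := 1 - s) hr).2 (by linarith)
    refine h.congr_fun (fun y hy => ?_) measurableSet_Ioo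
    have hy : 0 < y := hy.1
    simp only [Complex.finrank_real_complex, smul_eq_mul]
    rw [sub_eq_add_neg, rpow_add hy, rpow_one]
    norm_num

/-- The two-pole kernel with poles at `0` and at a unit vector is dominated by a fixed function
plus a translate of a fixed function. -/
lemma two_pole_kernel_le {β : ℝ} (hβ0 : 0 < β) (hβ1 : β < 1) {u : ℂ} (hu : ‖u‖ = 1) (w : ℂ) :
    1 / (‖w‖ ^ (1 + β) * ‖w - u‖) ≤
      (2 * (Metric.ball (0 : ℂ) (1 / 2)).indicator (fun w => ‖w‖ ^ (-(1 + β))) w +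
        45 * (1 + ‖w‖) ^ (-(2 + β))) +
      4 * (Metric.ball (0 : ℂ) (1 / 2)).indicator (fun w => ‖w‖ ^ (-1 : ℝ)) (w - u) := by
  have hφ : ∀ (s : ℝ) (v : ℂ),
      0 ≤ (Metric.ball (0 : ℂ) (1 / 2)).indicator (fun w => ‖w‖ ^ s) v :=
    fun s v => Set.indicator_nonneg (fun _ _ => by positivity) v
  have htail : 0 ≤ (1 + ‖w‖) ^ (-(2 + β)) := by positivity
  have htri : 1 ≤ ‖w‖ + ‖w - u‖ := by
    calc 1 = ‖w - (w - u)‖ := by rw [sub_sub_cancel, hu]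
      _ ≤ _ := norm_sub_le _ _
  have htri' : ‖w‖ ≤ ‖w - u‖ + 1 := by
    calc ‖w‖ = ‖(w - u) + u‖ := by rw [sub_add_cancel]
      _ ≤ _ := norm_add_le _ _
      _ = _ := by rw [hu]
  rw [one_div, mul_inv, ← rpow_neg (norm_nonneg w)]
  by_cases h0 : ‖w‖ < 1 / 2
  · have h1 : ‖w - u‖⁻¹ ≤ 2 := by
      rw [inv_le_comm₀ (by linarith) (by norm_num)]; linarith
    have h2 : (Metric.ball (0 : ℂ) (1 / 2)).indicator (fun w => ‖w‖ ^ (-(1 + β))) w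
        = ‖w‖ ^ (-(1 + β)) := Set.indicator_of_mem (by simpa using h0) _
    have h3 := mul_le_mul_of_nonneg_left h1 (by positivity : 0 ≤ ‖w‖ ^ (-(1 + β)))
    have h4 := hφ (-1) (w - u)
    rw [h2]; linarith
  push Not at h0
  have h5 := hφ (-(1 + β)) w
  by_cases h1 : ‖w - u‖ < 1 / 2
  · have h2 : (Metric.ball (0 : ℂ) (1 / 2)).indicator (fun w => ‖w‖ ^ (-1 : ℝ)) (w - u)
        = ‖w - u‖⁻¹ := by
      rw [Set.indicator_of_mem (by simpa using h1), rpow_neg_one]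
    have h3 : ‖w‖ ^ (-(1 + β)) ≤ 4 := by
      calc ‖w‖ ^ (-(1 + β)) ≤ (1 / 2 : ℝ) ^ (-(1 + β)) :=
            rpow_le_rpow_of_nonpos (by norm_num) h0 (by linarith)
        _ ≤ (1 / 2 : ℝ) ^ (-2 : ℝ) :=
            rpow_le_rpow_of_exponent_ge (by norm_num) (by norm_num) (by linarith)
        _ = 4 := by rw [rpow_neg (by norm_num)]; norm_num
    have h4 := mul_le_mul_of_nonneg_right h3 (by positivity : 0 ≤ ‖w - u‖⁻¹)
    rw [h2]; linarith
  · push Not at h1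
    have h4 := hφ (-1) (w - u)
    have h6 : ‖w‖ ^ (-(1 + β)) ≤ 9 * (1 + ‖w‖) ^ (-(1 + β)) := by
      calc ‖w‖ ^ (-(1 + β)) ≤ ((1 / 3) * (1 + ‖w‖)) ^ (-(1 + β)) :=
            rpow_le_rpow_of_nonpos (by positivity) (by linarith) (by linarith)
        _ = (1 / 3 : ℝ) ^ (-(1 + β)) * (1 + ‖w‖) ^ (-(1 + β)) :=
            mul_rpow (by norm_num) (by positivity)
        _ ≤ (1 / 3 : ℝ) ^ (-2 : ℝ) * (1 + ‖w‖) ^ (-(1 + β)) := by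
            refine mul_le_mul_of_nonneg_right ?_ (by positivity)
            exact rpow_le_rpow_of_exponent_ge (by norm_num) (by norm_num) (by linarith)
        _ = 9 * (1 + ‖w‖) ^ (-(1 + β)) := by rw [rpow_neg (by norm_num)]; norm_num
    have h7 : ‖w - u‖⁻¹ ≤ 5 * (1 + ‖w‖)⁻¹ := by
      rw [← div_eq_mul_inv, inv_eq_one_div, div_le_div_iff₀ (by linarith) (by positivity)]
      linarith
    have h8 : (1 + ‖w‖) ^ (-(2 + β)) = (1 + ‖w‖) ^ (-(1 + β)) * (1 + ‖w‖)⁻¹ := by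
      rw [← rpow_neg_one (1 + ‖w‖), ← rpow_add (by positivity)]
      ring_nf
    have h9 := mul_le_mul h6 h7 (by positivity) (by positivity)
    rw [h8]; linarith

lemma exists_integrable_integral_two_pole_kernel_le {β : ℝ} (hβ0 : 0 < β) (hβ1 : β < 1) :
    ∃ C : ℝ, ∀ u : ℂ, ‖u‖ = 1 →
      Integrable (fun w : ℂ => 1 / (‖w‖ ^ (1 + β) * ‖w - u‖)) ∧
        ∫ w : ℂ, 1 / (‖w‖ ^ (1 + β) * ‖w - u‖) ≤ C := by
  have hφ : Integrable (fun w : ℂ =>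
      2 * (Metric.ball (0 : ℂ) (1 / 2)).indicator (fun w => ‖w‖ ^ (-(1 + β))) w +
        45 * (1 + ‖w‖) ^ (-(2 + β))) :=
    ((integrable_indicator_ball_norm_rpow (by linarith) _).const_mul 2).add
      ((integrable_one_add_norm (by simp; linarith)).const_mul 45)
  have hψ : Integrable (fun w : ℂ =>
      4 * (Metric.ball (0 : ℂ) (1 / 2)).indicator (fun w => ‖w‖ ^ (-1 : ℝ)) w) :=
    (integrable_indicator_ball_norm_rpow (by norm_num) _).const_mul 4
  refine ⟨(∫ w : ℂ, 2 * (Metric.ball (0 : ℂ) (1 / 2)).indicator (fun w => ‖w‖ ^ (-(1 + β))) w +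
        45 * (1 + ‖w‖) ^ (-(2 + β))) +
      ∫ w : ℂ, 4 * (Metric.ball (0 : ℂ) (1 / 2)).indicator (fun w => ‖w‖ ^ (-1 : ℝ)) w,
     fun u hu => ?_⟩
  have hsum := hφ.add (hψ.comp_sub_right u)
  have hint : Integrable (fun w : ℂ => 1 / (‖w‖ ^ (1 + β) * ‖w - u‖)) := by
    refine hsum.mono' (Measurable.aestronglyMeasurable (by fun_prop)) (.of_forall fun w => ?_)
    rw [norm_of_nonneg (by positivity)]
    exact two_pole_kernel_le hβ0 hβ1 hu w
  refine ⟨hint, (integral_mono hint hsum (two_pole_kernel_le hβ0 hβ1 hu)).trans ?_⟩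
  rw [integral_add' hφ (hψ.comp_sub_right u),
    integral_sub_right_eq_self (fun w : ℂ =>
      4 * (Metric.ball (0 : ℂ) (1 / 2)).indicator (fun w => ‖w‖ ^ (-1 : ℝ)) w) u]

/-- By homogeneity, the bound on the two-pole kernel is uniform in both poles. -/
lemma exists_integrable_rpow_mul_integral_le {β : ℝ} (hβ0 : 0 < β) (hβ1 : β < 1) :
    ∃ C : ℝ, ∀ a z : ℂ, z ≠ a →
      Integrable (fun ζ : ℂ => 1 / (‖ζ - a‖ ^ (1 + β) * ‖ζ - z‖)) ∧
        ‖z - a‖ ^ β * ∫ ζ : ℂ, 1 / (‖ζ - a‖ ^ (1 + β) * ‖ζ - z‖) ≤ C := by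
  obtain ⟨C, hC⟩ := exists_integrable_integral_two_pole_kernel_le hβ0 hβ1
  refine ⟨C, fun a z hz => ?_⟩
  set r := ‖z - a‖ with hr
  have hr0 : 0 < r := norm_pos_iff.2 (sub_ne_zero.2 hz)
  set u : ℂ := r⁻¹ • (z - a) with hu
  have hu1 : ‖u‖ = 1 := by
    rw [hu, norm_smul, norm_inv, norm_of_nonneg hr0.le, ← hr, inv_mul_cancel₀ hr0.ne']
  have hza : z - a = r • u := by rw [hu, smul_inv_smul₀ hr0.ne']
  obtain ⟨hi, hb⟩ := hC u hu1
  let F : ℂ → ℝ := fun w => 1 / (‖w‖ ^ (1 + β) * ‖w - (z - a)‖)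
  have hFa : (fun ζ : ℂ => 1 / (‖ζ - a‖ ^ (1 + β) * ‖ζ - z‖)) = fun ζ => F (ζ - a) := by
    funext ζ
    simp only [F, sub_sub_sub_cancel_right]
  have hFr : (fun w => F (r • w)) =
      fun w => (r ^ (2 + β))⁻¹ * (1 / (‖w‖ ^ (1 + β) * ‖w - u‖)) := by
    funext w
    simp only [F]
    rw [hza, ← smul_sub, norm_smul, norm_smul, norm_of_nonneg hr0.le,
      mul_rpow hr0.le (norm_nonneg w), show 2 + β = (1 + β) + 1 by ring, rpow_add hr0 (1 + β) 1,
      rpow_one]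
    simp only [one_div, mul_inv]
    ring
  have hFint : Integrable F := by
    rw [← integrable_comp_smul_iff volume F hr0.ne', hFr]
    exact hi.const_mul _
  rw [hFa]
  refine ⟨hFint.comp_sub_right a, ?_⟩
  rw [integral_sub_right_eq_self F a]
  have hsc := Measure.integral_comp_smul volume F r
  rw [hFr, integral_const_mul, Complex.finrank_real_complex, smul_eq_mul,
    abs_of_pos (by positivity)] at hsc
  have : r ^ β * ∫ w, F w = ∫ w : ℂ, 1 / (‖w‖ ^ (1 + β) * ‖w - u‖) := by
    have h2 : r ^ (2 + β) = r ^ 2 * r ^ β := by rw [rpow_add hr0]; norm_num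
    have hp : 0 < r ^ β := rpow_pos_of_pos hr0 β
    rw [h2] at hsc
    field_simp at hsc
    linarith
  rw [this]
  exact hb



/-- The operator `(P_{G,a}f)(z) = (T_{G,a}(Af + B conj f))(z)` satisfies the
Lipschitz estimate
`‖P_{G,a}f₁ - P_{G,a}f₂‖_{C_{β-1}(Ḡ,a)} ≤ μ M_β(G) ‖f₁ - f₂‖_{C_{β-1}(Ḡ,a)}`,
where `μ = ‖A‖_{S_1(G,a)} + ‖B‖_{S_1(G,a)}`. -/
theorem P_Ga_lipschitz
    (G : Set ℂ) (hGo : IsOpen G) (hGb : Bornology.IsBounded G)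
    (a : ℂ) (ha : a ∈ G) (β : ℝ) (hβ0 : 0 < β) (hβ1 : β < 1)
    (A B f₁ f₂ : ℂ → ℂ) (hA : Measurable A) (hB : Measurable B)
    (hf₁ : Measurable f₁) (hf₂ : Measurable f₂)
    -- `μ = ‖A‖_{S_1(G,a)} + ‖B‖_{S_1(G,a)}`
    (μ nA nB : ℝ)
    (hnA : nA = essSup (fun z => ‖z - a‖ * ‖A z‖) (volume.restrict G))
    (hnB : nB = essSup (fun z => ‖z - a‖ * ‖B z‖) (volume.restrict G))
    (hμ : μ = nA + nB)
    (hAb : ∀ᵐ z ∂(volume.restrict G), ‖z - a‖ * ‖A z‖ ≤ nA)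
    (hBb : ∀ᵐ z ∂(volume.restrict G), ‖z - a‖ * ‖B z‖ ≤ nB)
    -- the operators `T_G` and `P_{G,a}`
    (T : (ℂ → ℂ) → ℂ → ℂ)
    (hT : ∀ g z, T g z = -(1 / (π : ℂ)) * ∫ ζ in G, g ζ / (ζ - z))
    (P : (ℂ → ℂ) → ℂ → ℂ)
    (hP : ∀ g z, P g z =
      T (fun ζ => A ζ * g ζ + B ζ * (starRingEnd ℂ) (g ζ)) z -
      T (fun ζ => A ζ * g ζ + B ζ * (starRingEnd ℂ) (g ζ)) a)
    (hint : ∀ g ∈ ({f₁, f₂} : Set (ℂ → ℂ)), ∀ z ∈ G,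
      Integrable (fun ζ => (A ζ * g ζ + B ζ * (starRingEnd ℂ) (g ζ)) / (ζ - z))
        (volume.restrict G))
    -- the constant `M_β(G)`
    (Mβ : ℝ)
    (hM : Mβ = sSup {r : ℝ | ∃ z ∈ G,
      r = ‖z - a‖ ^ β / π * ∫ ζ in G, 1 / (‖ζ - a‖ ^ (1 + β) * ‖ζ - z‖)})
    -- `‖f₁ - f₂‖_{C_{β-1}(Ḡ,a)} = nd`
    (nd : ℝ) (hnd : ∀ z ∈ closure G, z ≠ a → ‖z - a‖ ^ (β - 1) * ‖f₁ z - f₂ z‖ ≤ nd) :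
    ∀ z ∈ G, z ≠ a → ‖z - a‖ ^ (β - 1) * ‖P f₁ z - P f₂ z‖ ≤ μ * Mβ * nd := by
  subst hμ
  intro z hz hza
  obtain ⟨C, hC⟩ := exists_integrable_rpow_mul_integral_le hβ0 hβ1
  have hr0 : 0 < ‖z - a‖ := norm_pos_iff.2 (sub_ne_zero.2 hza)
  have hKint := ((hC a z hza).1).integrableOn (s := G)
  have hnd0 : 0 ≤ nd := le_trans (by positivity) (hnd z (subset_closure hz) hza)
  have hne : (ae (volume.restrict G)).NeBot := by
    rw [ae_restrict_neBot]
    exact (hGo.measure_pos volume ⟨a, ha⟩).ne'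
  have hμ0 : 0 ≤ nA + nB := by
    obtain ⟨ζ, h1, h2⟩ := (hAb.and hBb).exists
    have : 0 ≤ ‖ζ - a‖ * ‖A ζ‖ := by positivity
    have : 0 ≤ ‖ζ - a‖ * ‖B ζ‖ := by positivity
    linarith
  have hMz : ‖z - a‖ ^ β / π * ∫ ζ in G, 1 / (‖ζ - a‖ ^ (1 + β) * ‖ζ - z‖) ≤ Mβ := by
    rw [hM]
    refine le_csSup ⟨max 0 (C / π), ?_⟩ ⟨z, hz, rfl⟩
    rintro _ ⟨x, -, rfl⟩
    rcases eq_or_ne x a with rfl | hxa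
    · simp [zero_rpow hβ0.ne']
    · refine le_max_of_le_right ?_
      rw [div_mul_eq_mul_div]
      gcongr
      refine le_trans (mul_le_mul_of_nonneg_left ?_ (by positivity)) (hC a x hxa).2
      exact setIntegral_le_integral (hC a x hxa).1 (.of_forall fun ζ => by positivity)
  have hP' : P f₁ z - P f₂ z = -(1 / (π : ℂ)) * ∫ ζ in G,
      (((A ζ * f₁ ζ + B ζ * (starRingEnd ℂ) (f₁ ζ)) / (ζ - z) -
        (A ζ * f₁ ζ + B ζ * (starRingEnd ℂ) (f₁ ζ)) / (ζ - a)) -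
      ((A ζ * f₂ ζ + B ζ * (starRingEnd ℂ) (f₂ ζ)) / (ζ - z) -
        (A ζ * f₂ ζ + B ζ * (starRingEnd ℂ) (f₂ ζ)) / (ζ - a))) := by
    have i1 := hint f₁ (by simp) z hz
    have i2 := hint f₁ (by simp) a ha
    have i3 := hint f₂ (by simp) z hz
    have i4 := hint f₂ (by simp) a ha
    have h := integral_sub (i1.sub i2) (i3.sub i4)
    simp only [Pi.sub_apply] at h
    rw [h, integral_sub i1 i2, integral_sub i3 i4, hP, hP, hT, hT, hT, hT]
    ring
  have hae : ∀ x : ℂ, ∀ᵐ ζ ∂(volume.restrict G), ζ ≠ x := fun x =>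
    ae_restrict_of_ae (Measure.ae_ne volume x)
  have hbound := norm_integral_le_of_norm_le
    (hKint.const_mul (‖z - a‖ * ((nA + nB) * nd)))
    (f := fun ζ => (((A ζ * f₁ ζ + B ζ * (starRingEnd ℂ) (f₁ ζ)) / (ζ - z) -
        (A ζ * f₁ ζ + B ζ * (starRingEnd ℂ) (f₁ ζ)) / (ζ - a)) -
      ((A ζ * f₂ ζ + B ζ * (starRingEnd ℂ) (f₂ ζ)) / (ζ - z) -
        (A ζ * f₂ ζ + B ζ * (starRingEnd ℂ) (f₂ ζ)) / (ζ - a)))) (by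
      filter_upwards [hAb, hBb, hae a, hae z, ae_restrict_mem hGo.measurableSet]
        with ζ hAζ hBζ hζa hζz hζG
      have hs : 0 < ‖ζ - a‖ := norm_pos_iff.2 (sub_ne_zero.2 hζa)
      have ht : 0 < ‖ζ - z‖ := norm_pos_iff.2 (sub_ne_zero.2 hζz)
      have hζa' := sub_ne_zero.2 hζa
      have hζz' := sub_ne_zero.2 hζz
      have hfac : (((A ζ * f₁ ζ + B ζ * (starRingEnd ℂ) (f₁ ζ)) / (ζ - z) -
          (A ζ * f₁ ζ + B ζ * (starRingEnd ℂ) (f₁ ζ)) / (ζ - a)) -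
        ((A ζ * f₂ ζ + B ζ * (starRingEnd ℂ) (f₂ ζ)) / (ζ - z) -
          (A ζ * f₂ ζ + B ζ * (starRingEnd ℂ) (f₂ ζ)) / (ζ - a))) =
          (z - a) * (A ζ * (f₁ ζ - f₂ ζ) + B ζ * (starRingEnd ℂ) (f₁ ζ - f₂ ζ)) /
            ((ζ - a) * (ζ - z)) := by
        rw [map_sub]
        field_simp
        ring
      have hd := hnd ζ (subset_closure hζG) hζa
      have hnum : ‖ζ - a‖ ^ β *
          ‖A ζ * (f₁ ζ - f₂ ζ) + B ζ * (starRingEnd ℂ) (f₁ ζ - f₂ ζ)‖ ≤ (nA + nB) * nd := by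
        calc ‖ζ - a‖ ^ β * ‖A ζ * (f₁ ζ - f₂ ζ) + B ζ * (starRingEnd ℂ) (f₁ ζ - f₂ ζ)‖
            ≤ ‖ζ - a‖ ^ β * (‖A ζ‖ * ‖f₁ ζ - f₂ ζ‖ + ‖B ζ‖ * ‖f₁ ζ - f₂ ζ‖) := by
              gcongr
              refine (norm_add_le _ _).trans_eq ?_
              rw [norm_mul, norm_mul, RCLike.norm_conj]
          _ = (‖ζ - a‖ * ‖A ζ‖ + ‖ζ - a‖ * ‖B ζ‖) *
                (‖ζ - a‖ ^ (β - 1) * ‖f₁ ζ - f₂ ζ‖) := by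
              rw [rpow_sub_one hs.ne']
              field_simp
          _ ≤ (nA + nB) * nd := by gcongr
      rw [hfac, norm_div, norm_mul, norm_mul, rpow_add hs, rpow_one, mul_one_div,
        div_le_div_iff₀ (by positivity) (by positivity)]
      have := mul_le_mul_of_nonneg_left hnum
        (by positivity : 0 ≤ ‖z - a‖ * (‖ζ - a‖ * ‖ζ - z‖))
      linarith)
  rw [integral_const_mul] at hbound
  calc ‖z - a‖ ^ (β - 1) * ‖P f₁ z - P f₂ z‖
      ≤ ‖z - a‖ ^ (β - 1) * (1 / π * (‖z - a‖ * ((nA + nB) * nd) *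
          ∫ ζ in G, 1 / (‖ζ - a‖ ^ (1 + β) * ‖ζ - z‖))) := by
        rw [hP', norm_mul, norm_neg, norm_div, norm_one, Complex.norm_real,
          norm_of_nonneg pi_pos.le]
        gcongr
    _ = (nA + nB) * nd *
          (‖z - a‖ ^ β / π * ∫ ζ in G, 1 / (‖ζ - a‖ ^ (1 + β) * ‖ζ - z‖)) := by
        rw [rpow_sub_one hr0.ne']
        field_simp
    _ ≤ (nA + nB) * nd * Mβ := by gcongr
    _ = (nA + nB) * Mβ * nd := by ring
end
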